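/- With the notation of the context, let in addition a' > 0 and b' be real numbers, let m̃ : ℝ → ℝ be measurable, let j, j' ∈ ℤ, and assume that y ↦ m̃(y)·A_j^{a,b}(y)·B_{j'}^{a',b'}(y) is Lebesgue-integrable on ℝ. Then the matrix element M^j_{j'}(a,b;a',b') := ∫_ℝ m̃(y)·A_j^{a,b}(y)·B_{j'}^{a',b'}(y) dy is a real number (its imaginary part vanishes). This is equation (5.21) of the paper. -/

import Mathlib

open MeasureTheory Complex Real

/-- The pole location `y_j = h(j+β) + iπ/γ`. -/
noncomputable def poleY (h β : ℝ) (γ : ℕ) (j : ℤ) : ℂ :=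
  ((h * (j + β) : ℝ) : ℂ) + Complex.I * Real.pi / γ

/-- `A_j^{a,b}(y) = ∫ exp((N/2)·conj(y_j) + iω(conj(y_j)−y)) · exp(−ah(ω+ib)²) ·
(1 − exp((π/γ)(2ω−iN)))⁻¹ dω`. -/
noncomputable def Afun (h : ℝ) (N γ : ℕ) (β a b : ℝ) (j : ℤ) (y : ℝ) : ℂ :=
  ∫ ω : ℝ,
    Complex.exp ((N : ℂ) / 2 * (starRingEnd ℂ) (poleY h β γ j)
        + Complex.I * ω * ((starRingEnd ℂ) (poleY h β γ j) - y))
      * Complex.exp (-(a * h) * ((ω : ℂ) + Complex.I * b) ^ 2)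
      * (1 - Complex.exp (((Real.pi / γ : ℝ) : ℂ) * (2 * ω - Complex.I * N)))⁻¹

/-- `B_j^{a,b}(y) = ∫ exp((N/2)·y_j − iω(y_j−y)) · exp(−ah(ω−ib)²) ·
(1 − exp((π/γ)(2ω+iN)))⁻¹ dω`. -/
noncomputable def Bfun (h : ℝ) (N γ : ℕ) (β a b : ℝ) (j : ℤ) (y : ℝ) : ℂ :=
  ∫ ω : ℝ,
    Complex.exp ((N : ℂ) / 2 * poleY h β γ j
        - Complex.I * ω * (poleY h β γ j - y))
      * Complex.exp (-(a * h) * ((ω : ℂ) - Complex.I * b) ^ 2)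
      * (1 - Complex.exp (((Real.pi / γ : ℝ) : ℂ) * (2 * ω + Complex.I * N)))⁻¹

lemma phaseN (N γ : ℕ) (hγ : 0 < γ) (hodd : ∃ p : ℕ, Odd p ∧ N = γ * p) :
    Complex.exp (Complex.I * Real.pi * N / γ) = -1 := by
  obtain ⟨p, ⟨k, hk⟩, rfl⟩ := hodd
  have h0 : (γ : ℂ) ≠ 0 := by exact_mod_cast hγ.ne'
  have e : Complex.I * Real.pi * ((γ * p : ℕ) : ℂ) / γ
      = Real.pi * Complex.I + k * (2 * Real.pi * Complex.I) := by
    subst hk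
    push_cast
    field_simp
    ring
  rw [e, Complex.exp_add, Complex.exp_nat_mul_two_pi_mul_I, Complex.exp_pi_mul_I]
  ring

lemma denA (N γ : ℕ) (hγ : 0 < γ) (hodd : ∃ p : ℕ, Odd p ∧ N = γ * p) (ω : ℝ) :
    Complex.exp (((Real.pi / γ : ℝ) : ℂ) * (2 * ω - Complex.I * N))
      = -Complex.exp (2 * Real.pi * ω / γ) := by
  have e : ((Real.pi / γ : ℝ) : ℂ) * (2 * ω - Complex.I * N)
      = 2 * Real.pi * ω / γ - Complex.I * Real.pi * N / γ := by
    push_cast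
    ring
  rw [e, Complex.exp_sub, phaseN N γ hγ hodd]
  ring

lemma denB (N γ : ℕ) (hγ : 0 < γ) (hodd : ∃ p : ℕ, Odd p ∧ N = γ * p) (ω : ℝ) :
    Complex.exp (((Real.pi / γ : ℝ) : ℂ) * (2 * ω + Complex.I * N))
      = -Complex.exp (2 * Real.pi * ω / γ) := by
  have e : ((Real.pi / γ : ℝ) : ℂ) * (2 * ω + Complex.I * N)
      = 2 * Real.pi * ω / γ + Complex.I * Real.pi * N / γ := by
    push_cast
    ring
  rw [e, Complex.exp_add, phaseN N γ hγ hodd]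
  ring

lemma conj_poleY (h β : ℝ) (γ : ℕ) (j : ℤ) :
    (starRingEnd ℂ) (poleY h β γ j)
      = ((h * (j + β) : ℝ) : ℂ) - Complex.I * Real.pi / γ := by
  simp only [poleY, map_add, map_div₀, map_mul, Complex.conj_I, Complex.conj_ofReal, map_natCast]
  ring

lemma den_pos (γ : ℕ) (ω : ℝ) : (1 : ℂ) + Complex.exp (2 * Real.pi * ω / γ) ≠ 0 := by
  have e : (1 : ℂ) + Complex.exp (2 * Real.pi * ω / γ)
      = ((1 + Real.exp (2 * Real.pi * ω / γ) : ℝ) : ℂ) := by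
    push_cast
    rfl
  rw [e]
  exact_mod_cast (by positivity : (0 : ℝ) < 1 + Real.exp (2 * Real.pi * ω / γ)).ne'

lemma conj_Afun (h : ℝ) (N γ : ℕ) (hγ : 0 < γ) (hodd : ∃ p : ℕ, Odd p ∧ N = γ * p)
    (β a b : ℝ) (j : ℤ) (y : ℝ) :
    (starRingEnd ℂ) (Afun h N γ β a b j y) = Bfun h N γ β a b j y := by
  unfold Afun Bfun
  rw [← integral_conj]
  congr 1
  ext ω
  simp only [map_mul, map_inv₀, map_sub, map_add, map_one, map_neg, map_pow, map_div₀,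
    ← Complex.exp_conj, Complex.conj_I, Complex.conj_ofReal, map_natCast, Complex.conj_conj,
    map_ofNat]
  ring_nf

lemma Bfun_eq_neg_Afun (h : ℝ) (N γ : ℕ) (hγ : 0 < γ) (hodd : ∃ p : ℕ, Odd p ∧ N = γ * p)
    (β a b : ℝ) (j : ℤ) (y : ℝ) :
    Bfun h N γ β a b j y = -Afun h N γ β a b j y := by
  unfold Afun Bfun
  rw [← integral_neg_eq_self, ← integral_neg]
  congr 1
  ext ω
  rw [denA N γ hγ hodd, denB N γ hγ hodd, conj_poleY]
  unfold poleY
  have e1 : (N : ℂ) / 2 * (((h * (j + β) : ℝ) : ℂ) + Complex.I * Real.pi / γ)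
        - Complex.I * ((-ω : ℝ) : ℂ) * ((((h * (j + β) : ℝ) : ℂ) + Complex.I * Real.pi / γ) - y)
      = ((N : ℂ) / 2 * (((h * (j + β) : ℝ) : ℂ) - Complex.I * Real.pi / γ)
        + Complex.I * ω * ((((h * (j + β) : ℝ) : ℂ) - Complex.I * Real.pi / γ) - y))
        + Complex.I * Real.pi * N / γ + -(2 * Real.pi * ω / γ) := by
    push_cast
    linear_combination (2 * (Real.pi : ℂ) * ω / γ) * Complex.I_mul_I
  have e2 : (((-ω : ℝ) : ℂ) - Complex.I * b) ^ 2 = ((ω : ℂ) + Complex.I * b) ^ 2 := by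
    push_cast
    ring
  have e3 : (2 * Real.pi * ((-ω : ℝ) : ℂ) / γ) = -(2 * Real.pi * ω / γ) := by
    push_cast
    ring
  have hd := den_pos γ ω
  have hd2 := den_pos γ (-ω)
  rw [e3] at hd2
  rw [e1, e2, e3, Complex.exp_add, Complex.exp_add _ (Complex.I * Real.pi * N / γ),
    phaseN N γ hγ hodd, sub_neg_eq_add, sub_neg_eq_add]
  have key : Complex.exp (-(2 * Real.pi * ω / γ)) * (1 + Complex.exp (-(2 * Real.pi * ω / γ)))⁻¹
      = (1 + Complex.exp (2 * Real.pi * ω / γ))⁻¹ := by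
    have hm : Complex.exp (-(2 * Real.pi * ω / γ)) * Complex.exp (2 * Real.pi * ω / γ) = 1 := by
      rw [← Complex.exp_add]
      simp
    rw [← div_eq_mul_inv, div_eq_iff hd2, inv_mul_eq_div, eq_div_iff hd]
    linear_combination hm
  rw [← key]
  ring

/-- Equation (5.21): the matrix element
`M^j_{j'}(a,b;a',b') = ∫ m̃(y)·A_j^{a,b}(y)·B_{j'}^{a',b'}(y) dy` is real. -/
theorem matrix_element_real
    (h : ℝ) (hh : 0 < h) (N γ : ℕ) (hN : 0 < N) (hγ : 0 < γ)
    (hodd : ∃ p : ℕ, Odd p ∧ N = γ * p)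
    (β : ℝ) (hβ : β = 0 ∨ β = 1 / 2)
    (a b a' b' : ℝ) (ha : 0 < a) (ha' : 0 < a')
    (mt : ℝ → ℝ) (hmt : Measurable mt)
    (j j' : ℤ)
    (hint : Integrable (fun y : ℝ =>
      ((mt y : ℝ) : ℂ) * Afun h N γ β a b j y * Bfun h N γ β a' b' j' y)) :
    (∫ y : ℝ, ((mt y : ℝ) : ℂ) * Afun h N γ β a b j y * Bfun h N γ β a' b' j' y).im = 0 := by
  have hA : ∀ y, (starRingEnd ℂ) (Afun h N γ β a b j y) = -Afun h N γ β a b j y := fun y => by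
    rw [conj_Afun h N γ hγ hodd, Bfun_eq_neg_Afun h N γ hγ hodd]
  have hB : ∀ y, (starRingEnd ℂ) (Bfun h N γ β a' b' j' y) = -Bfun h N γ β a' b' j' y := fun y => by
    rw [← conj_Afun h N γ hγ hodd, Complex.conj_conj, conj_Afun h N γ hγ hodd,
      Bfun_eq_neg_Afun h N γ hγ hodd, neg_neg]
  rw [← Complex.conj_eq_iff_im, ← integral_conj]
  congr 1
  ext y
  rw [map_mul, map_mul, hA, hB, Complex.conj_ofReal]
  ring
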